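/- (Theorem 4.2, NTRU decryption correctness) Let N, d, p, q be positive integers with q > (6d+1)·p. Let f ∈ T(d+1,d) and g ∈ T(d,d), and suppose F_p, F_q ∈ ℤ[x] satisfy F_p ⋆ f ≡ 1 (mod p, x^N − 1) and F_q ⋆ f ≡ 1 (mod q, x^N − 1). Set h ≡ F_q ⋆ g (mod q, x^N − 1). Let m ∈ ℤ[x] be a plaintext of degree < N with all coefficients of absolute value at most p/2, let r ∈ T(d,d), and let e ≡ p·(h ⋆ r) + m (mod q, x^N − 1) be the ciphertext. Let a ∈ ℤ[x] be the polynomial of degree < N with all coefficients in (−q/2, q/2] satisfying a ≡ f ⋆ e (mod q, x^N − 1). Then F_p ⋆ a ≡ m (mod p, x^N − 1); i.e., decryption recovers the plaintext m. -/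

import Mathlib

open Polynomial

/-- The convolution product `a ⋆ b` in `R = ℤ[x]/(x^N − 1)`: the unique
representative of degree < N of `a·b` modulo `x^N − 1`, i.e. the remainder
of `a·b` upon division by the monic polynomial `x^N − 1`. -/
noncomputable def conv (N : ℕ) (a b : ℤ[X]) : ℤ[X] :=
  (a * b) %ₘ (X ^ N - 1)

/-- `Tern N d₁ d₂ a` says `a` is a ternary polynomial in `T(d₁,d₂)`:
`a` has degree < N, exactly `d₁` coefficients equal to `1`, exactly `d₂`
coefficients equal to `−1`, and all other coefficients equal to `0`. -/
def Tern (N d₁ d₂ : ℕ) (a : ℤ[X]) : Prop :=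
  a.degree < (N : WithBot ℕ) ∧
  ((Finset.range N).filter (fun i => a.coeff i = 1)).card = d₁ ∧
  ((Finset.range N).filter (fun i => a.coeff i = -1)).card = d₂ ∧
  ∀ i, a.coeff i = 0 ∨ a.coeff i = 1 ∨ a.coeff i = -1

/-- `ModCong N q u v` is the congruence `u ≡ v (mod q, x^N − 1)`:
`u − v` lies in the ideal of `ℤ[x]` generated by `q` and `x^N − 1`. -/
def ModCong (N : ℕ) (q : ℤ) (u v : ℤ[X]) : Prop :=
  u - v ∈ Ideal.span ({C q, X ^ N - 1} : Set ℤ[X])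

theorem modCong_iff_mk_eq {N : ℕ} {q : ℤ} {u v : ℤ[X]} :
    ModCong N q u v ↔
      Ideal.Quotient.mk (Ideal.span ({C q, X ^ N - 1} : Set ℤ[X])) u =
        Ideal.Quotient.mk (Ideal.span ({C q, X ^ N - 1} : Set ℤ[X])) v :=
  Ideal.Quotient.eq.symm

theorem mk_conv (N : ℕ) (q : ℤ) (a b : ℤ[X]) :
    Ideal.Quotient.mk (Ideal.span ({C q, X ^ N - 1} : Set ℤ[X])) (conv N a b) =
      Ideal.Quotient.mk _ a * Ideal.Quotient.mk _ b := by
  rw [← map_mul, Ideal.Quotient.eq, conv, modByMonic_eq_sub_mul_div]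
  have h : (X ^ N - 1 : ℤ[X]) ∈ Ideal.span ({C q, X ^ N - 1} : Set ℤ[X]) :=
    Ideal.subset_span (by simp)
  rw [sub_sub_cancel_left]
  exact neg_mem (Ideal.mul_mem_right _ _ h)

theorem monic_X_pow_sub_one {N : ℕ} (hN : 0 < N) : (X ^ N - 1 : ℤ[X]).Monic := by
  simpa using monic_X_pow_sub_C (1 : ℤ) hN.ne'

theorem degree_X_pow_sub_one {N : ℕ} (hN : 0 < N) :
    (X ^ N - 1 : ℤ[X]).degree = (N : WithBot ℕ) := by
  simpa using degree_X_pow_sub_C hN (1 : ℤ)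

theorem degree_conv_lt {N : ℕ} (hN : 0 < N) (a b : ℤ[X]) :
    (conv N a b).degree < (N : WithBot ℕ) := by
  rw [← degree_X_pow_sub_one hN]
  exact degree_modByMonic_lt _ (monic_X_pow_sub_one hN)

/-- Two polynomials of degree `< N` that are congruent modulo `(q, x^N − 1)` have
congruent coefficients modulo `q`. -/
theorem ModCong.dvd_coeff_sub {N : ℕ} (hN : 0 < N) {q : ℤ} {u v : ℤ[X]}
    (h : ModCong N q u v) (hu : u.degree < (N : WithBot ℕ)) (hv : v.degree < (N : WithBot ℕ))
    (k : ℕ) : q ∣ u.coeff k - v.coeff k := by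
  obtain ⟨s, t, hst⟩ := Ideal.mem_span_pair.mp h
  have hM := monic_X_pow_sub_one hN
  have hdeg : (u - v).degree < (X ^ N - 1 : ℤ[X]).degree := by
    rw [degree_X_pow_sub_one hN]
    exact (degree_sub_le _ _).trans_lt (max_lt hu hv)
  have hred : u - v = q • (s %ₘ (X ^ N - 1)) := by
    rw [← (modByMonic_eq_self_iff hM).mpr hdeg, ← hst, add_modByMonic,
      (modByMonic_eq_zero_iff_dvd hM).mpr (dvd_mul_left _ t), add_zero, mul_comm s,
      ← smul_eq_C_mul, smul_modByMonic]
  rw [← coeff_sub, hred, coeff_smul, smul_eq_mul]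
  exact dvd_mul_right _ _

/-- Multiplying by `x` modulo `x^N − 1` cyclically shifts the coefficients. -/
theorem X_mul_modByMonic {N : ℕ} (hN : 0 < N) {m : ℤ[X]} (hm : m.degree < (N : WithBot ℕ)) :
    (X * m) %ₘ (X ^ N - 1) = X * m - C (m.coeff (N - 1)) * (X ^ N - 1) := by
  refine (div_modByMonic_unique (C (m.coeff (N - 1))) _ (monic_X_pow_sub_one hN)
    ⟨by ring, ?_⟩).2
  rw [degree_X_pow_sub_one hN, degree_lt_iff_coeff_zero]
  intro k hk
  obtain ⟨j, rfl⟩ : ∃ j, k = j + 1 := ⟨k - 1, by omega⟩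
  rw [coeff_sub, coeff_X_mul, coeff_C_mul, coeff_sub, coeff_X_pow, coeff_one]
  rcases hk.eq_or_lt with rfl | hlt
  · simp
  · rw [(degree_lt_iff_coeff_zero m N).mp hm j (by omega)]
    simp [hlt.ne']

theorem abs_coeff_X_mul_modByMonic_le {N : ℕ} (hN : 0 < N) {B : ℤ} {m : ℤ[X]}
    (hm : m.degree < (N : WithBot ℕ)) (hB : ∀ i, |m.coeff i| ≤ B) (k : ℕ) :
    |((X * m) %ₘ (X ^ N - 1)).coeff k| ≤ B := by
  by_cases hk : N ≤ k
  · have hlt := degree_modByMonic_lt (X * m) (monic_X_pow_sub_one hN)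
    rw [degree_X_pow_sub_one hN] at hlt
    rw [(degree_lt_iff_coeff_zero _ N).mp hlt k hk, abs_zero]
    exact (abs_nonneg _).trans (hB 0)
  · rw [X_mul_modByMonic hN hm, coeff_sub, coeff_C_mul, coeff_sub, coeff_X_pow, coeff_one,
      if_neg (by omega : k ≠ N)]
    cases k with
    | zero => simpa using hB (N - 1)
    | succ j => simpa [coeff_X_mul] using hB j

theorem abs_coeff_X_pow_mul_modByMonic_le {N : ℕ} (hN : 0 < N) {B : ℤ} {m : ℤ[X]}
    (hm : m.degree < (N : WithBot ℕ)) (hB : ∀ i, |m.coeff i| ≤ B) (n k : ℕ) :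
    |((X ^ n * m) %ₘ (X ^ N - 1)).coeff k| ≤ B := by
  have hM := monic_X_pow_sub_one hN
  induction n generalizing k with
  | zero =>
    rw [pow_zero, one_mul,
      (modByMonic_eq_self_iff hM).mpr (by rwa [degree_X_pow_sub_one hN])]
    exact hB k
  | succ n ih =>
    have hlt := degree_modByMonic_lt (X ^ n * m) hM
    rw [degree_X_pow_sub_one hN] at hlt
    have hstep : (X ^ (n + 1) * m) %ₘ (X ^ N - 1) =
        (X * ((X ^ n * m) %ₘ (X ^ N - 1))) %ₘ (X ^ N - 1) := by
      refine modByMonic_eq_of_dvd_sub hM ⟨X * ((X ^ n * m) /ₘ (X ^ N - 1)), ?_⟩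
      rw [modByMonic_eq_sub_mul_div]
      ring
    rw [hstep]
    exact abs_coeff_X_mul_modByMonic_le hN hlt ih k

/-- The sup norm of a convolution is at most the `ℓ¹` norm of one factor times
the sup norm of the other. -/
theorem abs_coeff_conv_le {N : ℕ} (hN : 0 < N) {B : ℤ} {f m : ℤ[X]}
    (hf : f.degree < (N : WithBot ℕ)) (hm : m.degree < (N : WithBot ℕ))
    (hB : ∀ i, |m.coeff i| ≤ B) (k : ℕ) :
    |(conv N f m).coeff k| ≤ (∑ i ∈ Finset.range N, |f.coeff i|) * B := by
  have hsum : conv N f m =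
      ∑ i ∈ Finset.range N, f.coeff i • ((X ^ i * m) %ₘ (X ^ N - 1)) := by
    have hf' : f.natDegree < N := by
      rcases eq_or_ne f 0 with rfl | h0
      · simpa using hN
      · exact (natDegree_lt_iff_degree_lt h0).mpr hf
    conv_lhs => rw [conv, as_sum_range_C_mul_X_pow' f hf', Finset.sum_mul]
    change modByMonicHom (X ^ N - 1) _ = _
    rw [map_sum]
    refine Finset.sum_congr rfl fun i _ => ?_
    rw [mul_assoc, ← smul_eq_C_mul, map_smul]
    rfl
  rw [hsum, finsetSum_coeff, Finset.sum_mul]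
  refine (Finset.abs_sum_le_sum_abs _ _).trans (Finset.sum_le_sum fun i _ => ?_)
  rw [coeff_smul, smul_eq_mul, abs_mul]
  exact mul_le_mul_of_nonneg_left (abs_coeff_X_pow_mul_modByMonic_le hN hm hB i k)
    (abs_nonneg _)

theorem Tern.sum_abs_coeff {N d₁ d₂ : ℕ} {a : ℤ[X]} (h : Tern N d₁ d₂ a) :
    ∑ i ∈ Finset.range N, |a.coeff i| = d₁ + d₂ := by
  obtain ⟨-, h₁, h₂, hc⟩ := h
  rw [← h₁, ← h₂, Finset.card_filter, Finset.card_filter]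
  push_cast
  rw [← Finset.sum_add_distrib]
  refine Finset.sum_congr rfl fun i _ => ?_
  rcases hc i with h | h | h <;> simp [h]

theorem Tern.abs_coeff_le_one {N d₁ d₂ : ℕ} {a : ℤ[X]} (h : Tern N d₁ d₂ a) (i : ℕ) :
    |a.coeff i| ≤ 1 := by
  rcases h.2.2.2 i with h | h | h <;> simp [h]

/-- Theorem 4.2, NTRU decryption correctness: with parameters
`q > (6d+1)·p`, private key `f ∈ T(d+1,d)`, `g ∈ T(d,d)`, inverses
`F_p ⋆ f ≡ 1 (mod p, x^N − 1)` and `F_q ⋆ f ≡ 1 (mod q, x^N − 1)`, public key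
`h ≡ F_q ⋆ g (mod q, x^N − 1)`, plaintext `m` of degree < N with coefficients
of absolute value at most `p/2`, randomness `r ∈ T(d,d)`, ciphertext
`e ≡ p·(h ⋆ r) + m (mod q, x^N − 1)`, and `a` the centered lift (degree < N,
coefficients in `(−q/2, q/2]`) of `f ⋆ e` modulo `(q, x^N − 1)`, decryption
recovers the plaintext: `F_p ⋆ a ≡ m (mod p, x^N − 1)`. -/
theorem ntru_decryption_correct (N d : ℕ) (hN : 0 < N) (hd : 0 < d)
    (p q : ℤ) (hp : 0 < p) (hq : 0 < q) (hpq : (6 * (d : ℤ) + 1) * p < q)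
    (f g Fp Fq h m r e a : ℤ[X])
    (hf : Tern N (d + 1) d f) (hg : Tern N d d g)
    (hFp : ModCong N p (conv N Fp f) 1)
    (hFq : ModCong N q (conv N Fq f) 1)
    (hh : ModCong N q h (conv N Fq g))
    (hm : m.degree < (N : WithBot ℕ)) (hmc : ∀ i, 2 * |m.coeff i| ≤ p)
    (hr : Tern N d d r)
    (he : ModCong N q e (C p * conv N h r + m))
    (hadeg : a.degree < (N : WithBot ℕ))
    (hacoeff : ∀ i, -q < 2 * a.coeff i ∧ 2 * a.coeff i ≤ q)
    (hacong : ModCong N q a (conv N f e)) :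
    ModCong N p (conv N Fp a) m := by
  set b : ℤ[X] := C p * conv N g r + conv N f m with hb
  have hbdeg : b.degree < (N : WithBot ℕ) := by
    refine (degree_add_le _ _).trans_lt (max_lt ?_ (degree_conv_lt hN f m))
    rw [← smul_eq_C_mul]
    exact (degree_smul_le _ _).trans_lt (degree_conv_lt hN g r)
  have hab : ModCong N q a b := by
    rw [modCong_iff_mk_eq] at *
    simp only [hb, map_add, map_mul, mk_conv, map_one] at *
    rw [hacong, he, hh]
    linear_combination (Ideal.Quotient.mk _ (C p) * Ideal.Quotient.mk _ g *
      Ideal.Quotient.mk _ r) * hFq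
  have hbcoeff (k : ℕ) : 2 * |b.coeff k| < q := by
    have hgr := abs_coeff_conv_le hN hg.1 hr.1 hr.abs_coeff_le_one k
    have hfm := abs_coeff_conv_le hN hf.1 (m := C 2 * m) (B := p)
      (by rw [← smul_eq_C_mul]; exact (degree_smul_le _ _).trans_lt hm)
      (fun i => by simpa [abs_mul] using hmc i) k
    have htwo : conv N f (C 2 * m) = (2 : ℤ) • conv N f m := by
      rw [conv, conv, ← smul_modByMonic, ← smul_eq_C_mul, mul_smul_comm]
    rw [htwo, coeff_smul, smul_eq_mul, abs_mul, abs_two, hf.sum_abs_coeff] at hfm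
    rw [hg.sum_abs_coeff] at hgr
    push_cast at hfm
    have hadd := abs_add_le (p * (conv N g r).coeff k) ((conv N f m).coeff k)
    rw [abs_mul, abs_of_pos hp] at hadd
    have hmul := mul_le_mul_of_nonneg_left hgr hp.le
    rw [hb, coeff_add, coeff_C_mul]
    linarith
  have hEq : a = b := by
    ext k
    have hlt := abs_lt.mp (show |b.coeff k * 2| < q by
      rw [abs_mul, abs_two, mul_comm]; exact hbcoeff k)
    refine sub_eq_zero.mp (Int.eq_zero_of_abs_lt_dvd (hab.dvd_coeff_sub hN hadeg hbdeg k) ?_)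
    have := hacoeff k
    rw [abs_lt]
    constructor <;> linarith
  have hCp : Ideal.Quotient.mk (Ideal.span ({C p, X ^ N - 1} : Set ℤ[X])) (C p) = 0 :=
    Ideal.Quotient.eq_zero_iff_mem.mpr (Ideal.subset_span (by simp))
  rw [modCong_iff_mk_eq, mk_conv, map_one] at hFp
  rw [modCong_iff_mk_eq, mk_conv, hEq, hb, map_add, map_mul, mk_conv, mk_conv, hCp]
  linear_combination Ideal.Quotient.mk _ m * hFp
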